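/- arXiv:2408.16121 — 2 statements merged into one kernel-verified Lean document; each statement's English description precedes it below -/
import Mathlib

section
/- Every connected cubic graph on n = 4t+2 vertices contains a spanning subgraph with exactly t+2 vertices of degree 0, t+1 vertices of degree 1, t vertices of degree 2, and t−1 vertices of degree 3. -/
open SimpleGraph

/-- The degree of `v` in `H`, as the cardinality of its neighbor set. -/
noncomputable def nDeg {V : Type*} (H : SimpleGraph V) (v : V) : ℕ :=
  (H.neighborSet v).ncard

/-- The number of vertices of degree `k` in `H`. -/
noncomputable def degCount {V : Type*} (H : SimpleGraph V) (k : ℕ) : ℕ :=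
  {v | nDeg H v = k}.ncard

def K4 : SimpleGraph (Fin 4) := completeGraph (Fin 4)

def K33 : SimpleGraph (Fin 3 ⊕ Fin 3) := completeBipartiteGraph (Fin 3) (Fin 3)

/-- The disjoint union of `m` copies of `K₄`. -/
def unionK4 (m : ℕ) : SimpleGraph (Fin m × Fin 4) :=
  SimpleGraph.fromRel (fun p q => p.1 = q.1)

open Finset in
/-- If two maps on a finite set have fibers of size at most two, the set splits into a part where
the first map is injective and a part where the second map is injective. -/
theorem exists_injOn_injOn_sdiff {γ α β : Type*} [DecidableEq γ] [DecidableEq α] [DecidableEq β]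
    (f : γ → α) (g : γ → β) (K : Finset γ) (hf : ∀ a, #{p ∈ K | f p = a} ≤ 2)
    (hg : ∀ b, #{p ∈ K | g p = b} ≤ 2) :
    ∃ O ⊆ K, Set.InjOn f (O : Set γ) ∧ Set.InjOn g ((K \ O : Finset γ) : Set γ) := by
  let ends : K → Finset (α ⊕ β) := fun p => {Sum.inl (f p), Sum.inr (g p)}
  have hall : ∀ s : Finset K, #s ≤ #(s.biUnion ends) := by
    intro s
    have := card_mul_le_card_mul (s := s) (t := s.biUnion ends) (m := 2) (n := 2)
      (fun p v => v ∈ ends p) ?_ ?_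
    · omega
    · intro p hp
      have : bipartiteAbove (fun p v => v ∈ ends p) (s.biUnion ends) p = ends p := by
        ext v
        simp only [mem_bipartiteAbove, mem_biUnion]
        exact ⟨fun h => h.2, fun h => ⟨⟨p, hp, h⟩, h⟩⟩
      rw [this, card_pair (by simp)]
    · rintro (a | b) -
      · refine le_trans ?_ (hf a)
        refine card_le_card_of_injOn Subtype.val ?_ Subtype.val_injective.injOn
        intro p hp
        simp [ends] at hp ⊢
        exact hp.2.symm
      · refine le_trans ?_ (hg b)
        refine card_le_card_of_injOn Subtype.val ?_ Subtype.val_injective.injOn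
        intro p hp
        simp [ends] at hp ⊢
        exact hp.2.symm
  obtain ⟨φ, hφ, hmem⟩ := (all_card_le_biUnion_card_iff_exists_injective ends).1 hall
  have hends : ∀ p : K, φ p = Sum.inl (f p) ∨ φ p = Sum.inr (g p) := by
    intro p
    simpa [ends] using hmem p
  refine ⟨K.filter (fun p => ∃ h : p ∈ K, φ ⟨p, h⟩ = Sum.inl (f p)), filter_subset _ _, ?_, ?_⟩
  · intro p hp q hq hpq
    obtain ⟨-, hp, hφp⟩ := mem_filter.1 hp
    obtain ⟨-, hq, hφq⟩ := mem_filter.1 hq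
    exact congrArg Subtype.val (hφ (hφp.trans ((congrArg Sum.inl hpq).trans hφq.symm)))
  · intro p hp q hq hpq
    simp only [coe_sdiff, Set.mem_sdiff, mem_coe, mem_filter, not_and, not_exists] at hp hq
    have hφp := (hends ⟨p, hp.1⟩).resolve_left (hp.2 hp.1 hp.1)
    have hφq := (hends ⟨q, hq.1⟩).resolve_left (hq.2 hq.1 hq.1)
    exact congrArg Subtype.val (hφ (hφp.trans ((congrArg Sum.inr hpq).trans hφq.symm)))

open Finset in
/-- If a map has fibers of size at most two and is injective on less than half of a finite set,
then it stays injective after adding a suitable further element. -/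
theorem exists_insert_injOn {γ α : Type*} [DecidableEq γ] [DecidableEq α] {f : γ → α}
    {K O : Finset γ} (hf : ∀ a, #{p ∈ K | f p = a} ≤ 2) (hOK : O ⊆ K)
    (hO : Set.InjOn f (O : Set γ)) (hlt : #O < #(K \ O)) :
    ∃ p ∈ K \ O, Set.InjOn f ((insert p O : Finset γ) : Set γ) := by
  by_contra! hcon
  have hmem : ∀ p ∈ K \ O, f p ∈ O.image f := by
    intro p hp
    by_contra hnot
    refine hcon p hp ?_
    rw [coe_insert, Set.injOn_insert (by simpa using (mem_sdiff.1 hp).2)]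
    exact ⟨hO, by simpa using hnot⟩
  have hle : #(K \ O) ≤ #(O.image f) := by
    refine card_le_card_of_injOn f hmem ?_
    intro p hp q hq hpq
    by_contra hne
    obtain ⟨r, hr, hrp⟩ := mem_image.1 (hmem p hp)
    have hp' := mem_sdiff.1 hp
    have hq' := mem_sdiff.1 hq
    have hsub : ({p, q, r} : Finset γ) ⊆ {x ∈ K | f x = f p} := by
      intro x hx
      simp only [mem_insert, mem_singleton] at hx
      rcases hx with rfl | rfl | rfl
      · simp [hp'.1]
      · simp [hq'.1, hpq]
      · simp [hOK hr, hrp]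
    have h3 : #({p, q, r} : Finset γ) = 3 := by
      refine card_eq_three.2 ⟨p, q, r, hne, ?_, ?_, rfl⟩
      · rintro rfl
        exact hp'.2 hr
      · rintro rfl
        exact hq'.2 hr
    have := card_le_card hsub
    have := hf (f p)
    omega
  have := card_image_le (s := O) (f := f)
  omega

open Finset in
/-- The splitting of `exists_injOn_injOn_sdiff` can be chosen balanced. -/
theorem exists_injOn_injOn_sdiff_card {γ α β : Type*} [DecidableEq γ] [DecidableEq α]
    [DecidableEq β] (f : γ → α) (g : γ → β) (K : Finset γ) (hf : ∀ a, #{p ∈ K | f p = a} ≤ 2)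
    (hg : ∀ b, #{p ∈ K | g p = b} ≤ 2) {m k : ℕ} (hm : #K = 2 * m + 1) (hmk : m ≤ k)
    (hkm : k ≤ m + 1) :
    ∃ O ⊆ K, Set.InjOn f (O : Set γ) ∧ Set.InjOn g ((K \ O : Finset γ) : Set γ) ∧ #O = k := by
  suffices h : ∀ d, ∀ O ⊆ K, Set.InjOn f (O : Set γ) →
      Set.InjOn g ((K \ O : Finset γ) : Set γ) → #O - k + (k - #O) ≤ d →
      ∃ O ⊆ K, Set.InjOn f (O : Set γ) ∧ Set.InjOn g ((K \ O : Finset γ) : Set γ) ∧ #O = k by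
    obtain ⟨O, hOK, h1, h2⟩ := exists_injOn_injOn_sdiff f g K hf hg
    exact h _ O hOK h1 h2 le_rfl
  intro d
  induction d with
  | zero =>
    intro O hOK h1 h2 hd
    exact ⟨O, hOK, h1, h2, by omega⟩
  | succ d ih =>
    intro O hOK h1 h2 hd
    have hcard := card_sdiff_add_card_eq_card hOK
    rcases lt_trichotomy #O k with hlt | heq | hgt
    · obtain ⟨p, hp, hinj⟩ := exists_insert_injOn hf hOK h1 (by omega)
      have hp' := mem_sdiff.1 hp
      refine ih (insert p O) (insert_subset hp'.1 hOK) hinj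
        (h2.mono (coe_subset.2 (sdiff_subset_sdiff le_rfl (subset_insert _ _)))) ?_
      rw [card_insert_of_notMem hp'.2]
      omega
    · exact ⟨O, hOK, h1, h2, heq⟩
    · have hKO : K \ (K \ O) = O := Finset.sdiff_sdiff_eq_self hOK
      obtain ⟨p, hp, hinj⟩ := exists_insert_injOn hg sdiff_subset h2 (by rw [hKO]; omega)
      rw [hKO] at hp
      refine ih (O.erase p) ((erase_subset _ _).trans hOK)
        (h1.mono (coe_subset.2 (erase_subset _ _))) ?_ ?_
      · rwa [sdiff_erase (hOK hp)]
      · rw [card_erase_of_mem hp]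
        omega

open Finset Classical in
/-- The neighbors of `v` inside `S`. -/
noncomputable def nbrsIn {V : Type*} [Fintype V] (G : SimpleGraph V) (S : Finset V) (v : V) :
    Finset V :=
  {w | G.Adj v w ∧ w ∈ S}

open Finset Classical in
/-- The edges leaving `S`, as pairs whose first coordinate lies in `S`. -/
noncomputable def cutPairs {V : Type*} [Fintype V] (G : SimpleGraph V) (S : Finset V) :
    Finset (V × V) :=
  {p | G.Adj p.1 p.2 ∧ p.1 ∈ S ∧ p.2 ∉ S}

section Cubic

open Finset

variable {V : Type*} [Fintype V]

theorem mem_nbrsIn {G : SimpleGraph V} {S : Finset V} {v w : V} :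
    w ∈ nbrsIn G S v ↔ G.Adj v w ∧ w ∈ S := by
  simp [nbrsIn]

theorem mem_cutPairs {G : SimpleGraph V} {S : Finset V} {p : V × V} :
    p ∈ cutPairs G S ↔ G.Adj p.1 p.2 ∧ p.1 ∈ S ∧ p.2 ∉ S := by
  simp [cutPairs]

theorem nDeg_eq_card_nbrsIn (G : SimpleGraph V) (v : V) : nDeg G v = #(nbrsIn G univ v) := by
  rw [nDeg, ← Set.ncard_coe_finset]
  congr 1
  ext w
  simp [mem_nbrsIn]

theorem card_nbrsIn_add_compl [DecidableEq V] (G : SimpleGraph V) (S : Finset V) (v : V) :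
    #(nbrsIn G S v) + #(nbrsIn G Sᶜ v) = nDeg G v := by
  rw [nDeg_eq_card_nbrsIn, ← card_union_of_disjoint]
  · congr 1
    ext w
    simp only [mem_union, mem_nbrsIn, mem_compl, mem_univ]
    tauto
  · rw [Finset.disjoint_left]
    intro w h1 h2
    exact (mem_compl.1 (mem_nbrsIn.1 h2).2) (mem_nbrsIn.1 h1).2

theorem card_filter_cutPairs_fst [DecidableEq V] (G : SimpleGraph V) (S : Finset V) (v : V)
    (hv : v ∈ S) : #{p ∈ cutPairs G S | p.1 = v} = #(nbrsIn G Sᶜ v) := by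
  symm
  refine card_bij (fun w _ => (v, w)) ?_ ?_ ?_
  · intro w hw
    have := mem_nbrsIn.1 hw
    simp [mem_cutPairs, this.1, hv, mem_compl.1 this.2]
  · intro w _ w' _ h
    simpa using h
  · rintro ⟨a, b⟩ hp
    simp only [mem_filter, mem_cutPairs] at hp
    obtain ⟨⟨h1, h2, h3⟩, rfl⟩ := hp
    exact ⟨b, by simp [mem_nbrsIn, h1, h3], rfl⟩

theorem card_filter_cutPairs_snd [DecidableEq V] (G : SimpleGraph V) (S : Finset V) (v : V)
    (hv : v ∉ S) : #{p ∈ cutPairs G S | p.2 = v} = #(nbrsIn G S v) := by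
  symm
  refine card_bij (fun w _ => (w, v)) ?_ ?_ ?_
  · intro w hw
    have := mem_nbrsIn.1 hw
    simp [mem_cutPairs, this.1.symm, hv, this.2]
  · intro w _ w' _ h
    simpa using h
  · rintro ⟨a, b⟩ hp
    simp only [mem_filter, mem_cutPairs] at hp
    obtain ⟨⟨h1, h2, h3⟩, rfl⟩ := hp
    exact ⟨a, by simp [mem_nbrsIn, h1.symm, h2], rfl⟩

/-- How the number of edges leaving a set changes when a vertex is added to the set. -/
theorem card_cutPairs_insert [DecidableEq V] (G : SimpleGraph V) {S : Finset V} {v : V}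
    (hv : v ∉ S) :
    #(cutPairs G (insert v S)) + 2 * #(nbrsIn G S v) = #(cutPairs G S) + nDeg G v := by
  have h1 := card_filter_cutPairs_fst G (insert v S) v (mem_insert_self v S)
  have h2 := card_filter_cutPairs_snd G S v hv
  have h3 := card_nbrsIn_add_compl G (insert v S) v
  have h4 : nbrsIn G (insert v S) v = nbrsIn G S v := by
    ext w
    simp only [mem_nbrsIn, mem_insert]
    constructor
    · rintro ⟨h, rfl | h'⟩
      · exact absurd h (G.loopless.irrefl _)
      · exact ⟨h, h'⟩
    · tauto
  have h5 : {p ∈ cutPairs G (insert v S) | ¬ p.1 = v} = {p ∈ cutPairs G S | ¬ p.2 = v} := by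
    ext p
    simp only [mem_filter, mem_cutPairs, mem_insert, not_or]
    constructor
    · rintro ⟨⟨h, h' | h', h2, h3⟩, h4⟩
      · exact absurd h' h4
      · exact ⟨⟨h, h', h3⟩, h2⟩
    · rintro ⟨⟨h, h', h3⟩, h4⟩
      refine ⟨⟨h, Or.inr h', h4, h3⟩, ?_⟩
      rintro rfl
      exact hv h'
  have h6 := card_filter_add_card_filter_not (s := cutPairs G (insert v S)) (fun p => p.1 = v)
  have h7 := card_filter_add_card_filter_not (s := cutPairs G S) (fun p => p.2 = v)
  rw [h5] at h6
  rw [h4] at h3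
  omega

theorem exists_adj_notMem {G : SimpleGraph V} (hG : G.Connected) {S : Finset V}
    (hS : S.Nonempty) (hS' : S ≠ univ) : ∃ u ∈ S, ∃ v ∉ S, G.Adj u v := by
  obtain ⟨u, hu⟩ := hS
  obtain ⟨v, hv⟩ : ∃ v, v ∉ S := by simpa [Finset.eq_univ_iff_forall] using hS'
  obtain ⟨p⟩ := hG.preconnected u v
  obtain ⟨d, -, h1, h2⟩ := p.exists_boundary_dart (S : Set V) hu hv
  exact ⟨d.fst, h1, d.snd, h2, d.adj⟩

theorem card_cutPairs_mod_two [DecidableEq V] {G : SimpleGraph V} (hcubic : ∀ v, nDeg G v = 3)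
    (S : Finset V) : #(cutPairs G S) % 2 = #S % 2 := by
  induction S using Finset.induction_on with
  | empty => simp [cutPairs]
  | insert v S hv ih =>
    have := card_cutPairs_insert G hv
    rw [hcubic] at this
    rw [card_insert_of_notMem hv]
    omega

theorem exists_card_cutPairs_le [DecidableEq V] {G : SimpleGraph V} (hG : G.Connected)
    (hcubic : ∀ v, nDeg G v = 3) (k : ℕ) (hk : k + 1 ≤ Fintype.card V) :
    ∃ S : Finset V, #S = k + 1 ∧ #(cutPairs G S) ≤ k + 3 := by
  induction k with
  | zero =>
    obtain ⟨v⟩ := hG.nonempty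
    have h := card_cutPairs_insert G (notMem_empty v)
    have h0 : cutPairs G ∅ = ∅ := by simp [cutPairs]
    rw [hcubic, h0, card_empty] at h
    exact ⟨insert v ∅, by simp, by omega⟩
  | succ k ih =>
    obtain ⟨S, hS, hcut⟩ := ih (by omega)
    obtain ⟨u, hu, v, hv, huv⟩ := exists_adj_notMem hG (S := S) (card_pos.1 (by omega)) (by
      rintro rfl
      rw [card_univ] at hS
      omega)
    have h := card_cutPairs_insert G hv
    have hpos : 0 < #(nbrsIn G S v) := card_pos.2 ⟨u, mem_nbrsIn.2 ⟨huv.symm, hu⟩⟩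
    rw [hcubic] at h
    exact ⟨insert v S, by rw [card_insert_of_notMem hv, hS], by omega⟩

/-- A vertex set minimizing the number of leaving edges among the sets of its size: no vertex sends
three edges across the cut. -/
theorem exists_sparse_cut [DecidableEq V] {G : SimpleGraph V} (hG : G.Connected)
    (hcubic : ∀ v, nDeg G v = 3) (k : ℕ) (hk : k + 3 ≤ Fintype.card V) :
    ∃ S : Finset V, #S = k + 1 ∧ #(cutPairs G S) ≤ k + 3 ∧ (∀ v ∉ S, #(nbrsIn G S v) ≤ 2) ∧
      (0 < k → ∀ v ∈ S, #(nbrsIn G Sᶜ v) ≤ 2) := by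
  obtain ⟨S₀, hS₀, hcut₀⟩ := exists_card_cutPairs_le hG hcubic k (by omega)
  obtain ⟨S, hSmem, hmin⟩ := exists_min_image (univ.filter fun S : Finset V => #S = k + 1)
    (fun S => #(cutPairs G S)) ⟨S₀, by simpa using hS₀⟩
  have hS : #S = k + 1 := by simpa using hSmem
  replace hmin : ∀ T : Finset V, #T = k + 1 → #(cutPairs G S) ≤ #(cutPairs G T) := fun T hT =>
    hmin T (by simpa using hT)
  refine ⟨S, hS, (hmin S₀ hS₀).trans hcut₀, ?_, ?_⟩
  · intro b hb
    by_contra! hlt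
    have hcompl := card_nbrsIn_add_compl G S b
    have hins := card_cutPairs_insert G hb
    have hcard := card_insert_of_notMem hb
    rw [hcubic] at hcompl hins
    obtain ⟨u, hu, v, hv, huv⟩ := exists_adj_notMem hG (S := insert b S) ⟨b, mem_insert_self b S⟩
      (by
        intro h
        rw [h, card_univ] at hcard
        omega)
    have hub : u ≠ b := by
      rintro rfl
      have : v ∈ nbrsIn G Sᶜ u :=
        mem_nbrsIn.2 ⟨huv, mem_compl.2 fun h => hv (mem_insert_of_mem h)⟩
      have := card_pos.2 ⟨v, this⟩
      omega
    have hera := card_cutPairs_insert G (notMem_erase u (insert b S))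
    have hcomplu := card_nbrsIn_add_compl G ((insert b S).erase u) u
    have hpos : 0 < #(nbrsIn G ((insert b S).erase u)ᶜ u) :=
      card_pos.2 ⟨v, mem_nbrsIn.2 ⟨huv, mem_compl.2 fun h => hv (mem_of_mem_erase h)⟩⟩
    rw [insert_erase hu, hcubic] at hera
    rw [hcubic] at hcomplu
    have := hmin ((insert b S).erase u) (by rw [card_erase_of_mem hu, hcard, hS]; rfl)
    omega
  · intro hk0 a ha
    by_contra! hlt
    have hcompl := card_nbrsIn_add_compl G S a
    have hera := card_cutPairs_insert G (notMem_erase a S)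
    have hcard := card_erase_of_mem ha
    have hzero : nbrsIn G S a = ∅ := by
      rw [hcubic] at hcompl
      exact card_eq_zero.1 (by omega)
    have hzero' : nbrsIn G (S.erase a) a = ∅ := by
      refine subset_empty.1 fun w hw => ?_
      rw [← hzero]
      exact mem_nbrsIn.2 ⟨(mem_nbrsIn.1 hw).1, mem_of_mem_erase (mem_nbrsIn.1 hw).2⟩
    rw [insert_erase ha, hcubic, hzero', card_empty] at hera
    obtain ⟨u, hu, v, hv, huv⟩ := exists_adj_notMem hG (S := S.erase a) (card_pos.1 (by omega))
      (by
        intro h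
        exact notMem_erase a S (h ▸ mem_univ a))
    have hins := card_cutPairs_insert G hv
    have hpos : 0 < #(nbrsIn G (S.erase a) v) := card_pos.2 ⟨u, mem_nbrsIn.2 ⟨huv.symm, hu⟩⟩
    rw [hcubic] at hins
    have := hmin (insert v (S.erase a)) (by rw [card_insert_of_notMem hv]; omega)
    omega

theorem sum_degCount {G H : SimpleGraph V} (hcubic : ∀ v, nDeg G v = 3) (hH : H ≤ G) :
    degCount H 0 + degCount H 1 + degCount H 2 + degCount H 3 = Fintype.card V := by
  classical
  have hle : ∀ v ∈ (univ : Finset V), nDeg H v ∈ range 4 := fun v _ => by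
    have : nDeg H v ≤ nDeg G v := Set.ncard_le_ncard (fun w hw => hH hw)
    rw [hcubic] at this
    exact mem_range.2 (by omega)
  rw [← card_univ, card_eq_sum_card_fiberwise hle]
  simp [degCount, sum_range_succ, ← Set.ncard_coe_finset]

theorem nDeg_sdiff_add {G H : SimpleGraph V} (hH : H ≤ G) (v : V) :
    nDeg (G \ H) v + nDeg H v = nDeg G v := by
  rw [nDeg, nDeg, nDeg, ← Set.ncard_sdiff_add_ncard_of_subset (s := H.neighborSet v)
    (t := G.neighborSet v) (fun w hw => hH hw)]
  congr 2

theorem degCount_sdiff {G H : SimpleGraph V} (hcubic : ∀ v, nDeg G v = 3) (hH : H ≤ G)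
    {i j : ℕ} (hij : i + j = 3) : degCount (G \ H) i = degCount H j := by
  rw [degCount, degCount]
  congr 1
  ext v
  have := nDeg_sdiff_add hH v
  rw [hcubic] at this
  simp only [Set.mem_ofPred_eq]
  omega

theorem nDeg_deleteEdges_add_one {H : SimpleGraph V} {u v : V} (huv : H.Adj u v) :
    nDeg (H.deleteEdges {s(u, v)}) u + 1 = nDeg H u := by
  rw [nDeg, nDeg, ← Set.ncard_sdiff_singleton_add_one (s := H.neighborSet u) (a := v) huv]
  congr 2
  ext x
  simp only [mem_neighborSet, deleteEdges_adj, Set.mem_singleton_iff, Set.mem_sdiff, Sym2.eq_iff]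
  have := huv.ne
  grind

/-- Deleting an edge between two vertices of degree `k + 1` turns them into vertices of
degree `k`. -/
theorem exists_le_degCount_of_adj {H : SimpleGraph V} {u v : V} {k : ℕ} (huv : H.Adj u v)
    (hu : nDeg H u = k + 1) (hv : nDeg H v = k + 1) :
    ∃ H' ≤ H, degCount H' (k + 1) + 2 = degCount H (k + 1) ∧
      degCount H' k = degCount H k + 2 ∧
      ∀ i, i ≠ k → i ≠ k + 1 → degCount H' i = degCount H i := by
  obtain ⟨H', hle, hu', hv', hw⟩ : ∃ H' ≤ H, nDeg H' u + 1 = nDeg H u ∧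
      nDeg H' v + 1 = nDeg H v ∧ ∀ w, w ≠ u → w ≠ v → nDeg H' w = nDeg H w := by
    have hv' := nDeg_deleteEdges_add_one huv.symm
    rw [Sym2.eq_swap] at hv'
    refine ⟨H.deleteEdges {s(u, v)}, deleteEdges_le _, nDeg_deleteEdges_add_one huv, hv',
      fun w hu hv => ?_⟩
    rw [nDeg, nDeg]
    congr 1
    ext x
    simp [deleteEdges_adj, hu, hv]
  have hcases : ∀ w, w = u ∨ w = v ∨ nDeg H' w = nDeg H w := fun w => by
    by_cases h : w = u
    · exact Or.inl h
    · by_cases h' : w = v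
      · exact Or.inr (Or.inl h')
      · exact Or.inr (Or.inr (hw w h h'))
  have hpair : ({u, v} : Set V).ncard = 2 := Set.ncard_pair huv.ne
  refine ⟨H', hle, ?_, ?_, fun i hi hi' => ?_⟩
  · rw [degCount, degCount, ← hpair, ← Set.ncard_union_eq]
    · congr 1
      ext w
      simp only [Set.mem_union, Set.mem_ofPred_eq, Set.mem_insert_iff, Set.mem_singleton_iff]
      have := hcases w
      grind
    · rw [Set.disjoint_left]
      simp only [Set.mem_ofPred_eq, Set.mem_insert_iff, Set.mem_singleton_iff]
      grind
  · rw [degCount, degCount, ← hpair, ← Set.ncard_union_eq]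
    · congr 1
      ext w
      simp only [Set.mem_union, Set.mem_ofPred_eq, Set.mem_insert_iff, Set.mem_singleton_iff]
      have := hcases w
      grind
    · rw [Set.disjoint_left]
      simp only [Set.mem_ofPred_eq, Set.mem_insert_iff, Set.mem_singleton_iff]
      grind
  · rw [degCount, degCount]
    congr 1
    ext w
    simp only [Set.mem_ofPred_eq]
    have := hcases w
    grind

/-- If the vertices of degree 3 are independent, then counting the edges at them from both ends
bounds their number. -/
theorem three_mul_degCount_three_le {G H : SimpleGraph V} (hcubic : ∀ v, nDeg G v = 3)
    (hH : H ≤ G) (hind : ∀ u v, H.Adj u v → nDeg H u = 3 → nDeg H v ≠ 3) :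
    3 * degCount H 3 ≤ 2 * degCount H 2 + degCount H 1 := by
  classical
  have hcount : ∀ i, degCount H i = #{v : V | nDeg H v = i} := fun i => by
    simp [degCount, ← Set.ncard_coe_finset]
  have hle : ∀ v, nDeg H v ≤ 3 := fun v =>
    (Set.ncard_le_ncard fun w hw => hH hw).trans (hcubic v).le
  have hleft : ∀ u ∈ ({v : V | nDeg H v = 3} : Finset V),
      #(bipartiteAbove H.Adj univ u) = 3 := fun u hu => by
    rw [← (mem_filter.1 hu).2, nDeg_eq_card_nbrsIn]
    congr 1
    ext w
    simp [bipartiteAbove, mem_nbrsIn]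
  have hright : ∀ w ∈ (univ : Finset V),
      #(bipartiteBelow H.Adj {v : V | nDeg H v = 3} w) ≤
        2 * (if nDeg H w = 2 then 1 else 0) + (if nDeg H w = 1 then 1 else 0) := fun w _ => by
    have hsub : bipartiteBelow H.Adj {v : V | nDeg H v = 3} w ⊆ nbrsIn H univ w := fun x hx => by
      simp only [bipartiteBelow, mem_filter] at hx
      exact mem_nbrsIn.2 ⟨hx.2.symm, mem_univ x⟩
    have h1 := card_le_card hsub
    rw [← nDeg_eq_card_nbrsIn] at h1
    have h2 := hle w
    by_cases h3 : nDeg H w = 3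
    · rw [card_eq_zero.2]
      · simp
      · refine eq_empty_of_forall_notMem fun x hx => ?_
        simp only [bipartiteBelow, mem_filter] at hx
        exact hind x w hx.2 hx.1.2 h3
    · split_ifs <;> omega
  have hsum := sum_card_bipartiteAbove_eq_sum_card_bipartiteBelow (s := {v : V | nDeg H v = 3})
    (t := univ) H.Adj
  have := sum_le_sum hright
  rw [← hsum, sum_congr rfl hleft, sum_add_distrib, ← mul_sum, ← card_filter, ← card_filter,
    sum_const, smul_eq_mul] at this
  rw [hcount, hcount, hcount]
  omega

theorem three_mul_degCount_three_le_or {G H : SimpleGraph V} (hcubic : ∀ v, nDeg G v = 3)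
    (hH : H ≤ G) : 3 * degCount H 3 ≤ 2 * degCount H 2 + degCount H 1 ∨
      ∃ H' ≤ H, degCount H' 3 + 2 = degCount H 3 ∧ degCount H' 2 = degCount H 2 + 2 ∧
        degCount H' 1 = degCount H 1 ∧ degCount H' 0 = degCount H 0 := by
  by_cases hind : ∀ u v, H.Adj u v → nDeg H u = 3 → nDeg H v ≠ 3
  · exact Or.inl (three_mul_degCount_three_le hcubic hH hind)
  · push Not at hind
    obtain ⟨u, v, huv, hu, hv⟩ := hind
    obtain ⟨H', hle, h3, h2, hi⟩ := exists_le_degCount_of_adj huv hu hv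
    exact Or.inr ⟨H', hle, h3, h2, hi 1 (by norm_num) (by norm_num),
      hi 0 (by norm_num) (by norm_num)⟩

theorem three_mul_degCount_zero_le_or {G H : SimpleGraph V} (hcubic : ∀ v, nDeg G v = 3)
    (hH : H ≤ G) : 3 * degCount H 0 ≤ 2 * degCount H 1 + degCount H 2 ∨
      ∃ H' ≤ G, degCount H' 3 = degCount H 3 ∧ degCount H' 2 = degCount H 2 ∧
        degCount H' 1 = degCount H 1 + 2 ∧ degCount H' 0 + 2 = degCount H 0 := by
  have hc : ∀ {i j}, i + j = 3 → degCount (G \ H) i = degCount H j := degCount_sdiff hcubic hH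
  rcases three_mul_degCount_three_le_or hcubic (sdiff_le : G \ H ≤ G) with h | ⟨F, hF, h⟩
  · left
    rwa [hc (i := 3) (j := 0) rfl, hc (i := 2) (j := 1) rfl, hc (i := 1) (j := 2) rfl] at h
  · right
    have hFG := hF.trans sdiff_le
    rw [hc (i := 3) (j := 0) rfl, hc (i := 2) (j := 1) rfl, hc (i := 1) (j := 2) rfl,
      hc (i := 0) (j := 3) rfl] at h
    refine ⟨G \ F, sdiff_le, ?_⟩
    rw [degCount_sdiff hcubic hFG (i := 3) (j := 0) rfl,
      degCount_sdiff hcubic hFG (i := 2) (j := 1) rfl,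
      degCount_sdiff hcubic hFG (i := 1) (j := 2) rfl,
      degCount_sdiff hcubic hFG (i := 0) (j := 3) rfl]
    tauto

/-- Switching pairs of vertices of degrees 3 and 0 to degrees 2 and 1 until the prescribed numbers
are reached. -/
theorem exists_degCount_eq {G : SimpleGraph V} (hcubic : ∀ v, nDeg G v = 3) {t p q : ℕ}
    {H : SimpleGraph V} (hH : H ≤ G)
    (h23 : degCount H 2 + degCount H 3 + 1 = 2 * t) (h01 : degCount H 0 + degCount H 1 = 2 * t + 3)
    (h2 : degCount H 2 + 2 * p = t) (h1 : degCount H 1 + 2 * q = t + 1) :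
    ∃ H ≤ G, degCount H 0 = t + 2 ∧ degCount H 1 = t + 1 ∧
      degCount H 2 = t ∧ degCount H 3 = t - 1 := by
  induction p generalizing H with
  | zero =>
    induction q generalizing H with
    | zero => exact ⟨H, hH, by omega⟩
    | succ q ih =>
      rcases three_mul_degCount_zero_le_or hcubic hH with h | ⟨H', hH', h⟩
      · omega
      · exact ih hH' (by omega) (by omega) (by omega) (by omega)
  | succ p ih =>
    rcases three_mul_degCount_three_le_or hcubic hH with h | ⟨H', hH', h⟩
    · omega
    · exact ih (hH'.trans hH) (by omega) (by omega) (by omega) (by omega)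

/-- The graph obtained from `G` by deleting the edges inside the complement of `A` and the edges
leaving `A` that are listed in `O`. -/
def pruneCut (G : SimpleGraph V) (A : Finset V) (O : Finset (V × V)) : SimpleGraph V where
  Adj u v := G.Adj u v ∧ (u ∈ A ∨ v ∈ A) ∧ (u, v) ∉ O ∧ (v, u) ∉ O
  symm := ⟨fun _ _ h => ⟨h.1.symm, h.2.1.symm, h.2.2.2, h.2.2.1⟩⟩
  loopless := ⟨fun _ h => G.loopless.irrefl _ h.1⟩

section pruneCut

variable {G : SimpleGraph V} {A : Finset V} {O : Finset (V × V)}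

theorem nDeg_pruneCut_of_mem_image [DecidableEq V] (hO : O ⊆ cutPairs G A)
    (hinj : Set.InjOn Prod.fst (O : Set (V × V))) {a : V} (ha : a ∈ O.image Prod.fst) :
    nDeg (pruneCut G A O) a + 1 = nDeg G a := by
  obtain ⟨⟨a', b⟩, hp, rfl⟩ := mem_image.1 ha
  have hcut := mem_cutPairs.1 (hO hp)
  rw [nDeg, nDeg, ← Set.ncard_sdiff_singleton_add_one (s := G.neighborSet a') (a := b) hcut.1]
  congr 2
  ext x
  simp only [mem_neighborSet, pruneCut, Set.mem_sdiff, Set.mem_singleton_iff]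
  constructor
  · rintro ⟨h1, -, h2, -⟩
    exact ⟨h1, by rintro rfl; exact h2 hp⟩
  · rintro ⟨h1, h2⟩
    refine ⟨h1, Or.inl hcut.2.1, fun h => h2 ?_, fun h => ?_⟩
    · exact congrArg Prod.snd (hinj h hp rfl)
    · exact (mem_cutPairs.1 (hO h)).2.2 hcut.2.1

theorem nDeg_pruneCut_of_mem [DecidableEq V] (hO : O ⊆ cutPairs G A) {a : V} (ha : a ∈ A)
    (ha' : a ∉ O.image Prod.fst) : nDeg (pruneCut G A O) a = nDeg G a := by
  rw [nDeg, nDeg]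
  congr 1
  ext x
  simp only [mem_neighborSet, pruneCut]
  refine ⟨fun h => h.1, fun h => ⟨h, Or.inl ha, fun h' => ha' (mem_image_of_mem _ h'), fun h' => ?_⟩⟩
  exact (mem_cutPairs.1 (hO h')).2.2 ha

theorem mem_neighborSet_pruneCut [DecidableEq V] (hO : O ⊆ cutPairs G A) {b x : V} (hb : b ∉ A) :
    x ∈ (pruneCut G A O).neighborSet b ↔ (x, b) ∈ cutPairs G A \ O := by
  simp only [mem_neighborSet, pruneCut, mem_sdiff, mem_cutPairs]
  constructor
  · rintro ⟨h1, h2, -, h3⟩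
    exact ⟨⟨h1.symm, h2.resolve_left hb, hb⟩, h3⟩
  · rintro ⟨⟨h1, h2, -⟩, h3⟩
    exact ⟨h1.symm, Or.inr h2, fun h => hb (mem_cutPairs.1 (hO h)).2.1, h3⟩

theorem nDeg_pruneCut_of_notMem [DecidableEq V] (hO : O ⊆ cutPairs G A)
    (hinj : Set.InjOn Prod.snd (↑(cutPairs G A \ O) : Set (V × V))) {b : V} (hb : b ∉ A) :
    nDeg (pruneCut G A O) b = if b ∈ (cutPairs G A \ O).image Prod.snd then 1 else 0 := by
  split_ifs with h
  · obtain ⟨⟨a, b'⟩, hp, rfl⟩ := mem_image.1 h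
    rw [nDeg, Set.ncard_eq_one]
    refine ⟨a, Set.ext fun x => ?_⟩
    rw [mem_neighborSet_pruneCut hO hb, Set.mem_singleton_iff]
    exact ⟨fun hx => congrArg Prod.fst (hinj hx hp rfl), by rintro rfl; exact hp⟩
  · rw [nDeg, Set.ncard_eq_zero, Set.eq_empty_iff_forall_notMem]
    intro x hx
    rw [mem_neighborSet_pruneCut hO hb] at hx
    exact h (mem_image_of_mem _ hx)

theorem degCount_pruneCut [DecidableEq V] (hcubic : ∀ v, nDeg G v = 3) (hO : O ⊆ cutPairs G A)
    (hfst : Set.InjOn Prod.fst (O : Set (V × V)))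
    (hsnd : Set.InjOn Prod.snd (↑(cutPairs G A \ O) : Set (V × V))) :
    degCount (pruneCut G A O) 2 = #O ∧
      degCount (pruneCut G A O) 1 = #(cutPairs G A \ O) ∧
      degCount (pruneCut G A O) 2 + degCount (pruneCut G A O) 3 = #A := by
  have hsub : O.image Prod.fst ⊆ A := fun a ha => by
    obtain ⟨p, hp, rfl⟩ := mem_image.1 ha
    exact (mem_cutPairs.1 (hO hp)).2.1
  have hsub' : ∀ b ∈ (cutPairs G A \ O).image Prod.snd, b ∉ A := fun b hb => by
    obtain ⟨p, hp, rfl⟩ := mem_image.1 hb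
    exact (mem_cutPairs.1 (mem_sdiff.1 hp).1).2.2
  have hA : ∀ a ∈ O.image Prod.fst, nDeg (pruneCut G A O) a = 2 := fun a ha => by
    have := nDeg_pruneCut_of_mem_image hO hfst ha
    rw [hcubic] at this
    omega
  have hA' : ∀ a ∈ A, a ∉ O.image Prod.fst → nDeg (pruneCut G A O) a = 3 := fun a ha ha' => by
    rw [nDeg_pruneCut_of_mem hO ha ha', hcubic]
  have hB : ∀ b ∉ A, nDeg (pruneCut G A O) b =
      if b ∈ (cutPairs G A \ O).image Prod.snd then 1 else 0 := fun b hb =>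
    nDeg_pruneCut_of_notMem hO hsnd hb
  have h2 : degCount (pruneCut G A O) 2 = #(O.image Prod.fst) := by
    rw [degCount, ← Set.ncard_coe_finset]
    congr 1
    ext v
    simp only [Set.mem_ofPred_eq, mem_coe]
    by_cases hv : v ∈ A
    · have := hA v
      have := hA' v hv
      have := hsub' v
      grind
    · have := hB v hv
      have := @hsub v
      grind
  have h1 : degCount (pruneCut G A O) 1 = #((cutPairs G A \ O).image Prod.snd) := by
    rw [degCount, ← Set.ncard_coe_finset]
    congr 1
    ext v
    simp only [Set.mem_ofPred_eq, mem_coe]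
    by_cases hv : v ∈ A
    · have := hA v
      have := hA' v hv
      have := hsub' v
      grind
    · have := hB v hv
      have := @hsub v
      grind
  have h3 : degCount (pruneCut G A O) 3 = #(A \ O.image Prod.fst) := by
    rw [degCount, ← Set.ncard_coe_finset]
    congr 1
    ext v
    simp only [Set.mem_ofPred_eq, mem_coe, mem_sdiff]
    by_cases hv : v ∈ A
    · have := hA v
      have := hA' v hv
      have := hsub' v
      grind
    · have := hB v hv
      have := @hsub v
      grind
  refine ⟨h2.trans (card_image_of_injOn hfst), h1.trans (card_image_of_injOn hsnd), ?_⟩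
  rw [h2, h3, add_comm, card_sdiff_add_card_eq_card hsub]

end pruneCut

/-- The edges leaving a sparse set split into a part meeting each inner vertex at most once and a
part meeting each outer vertex at most once, with prescribed parity of the sizes. -/
theorem exists_split_cutPairs [DecidableEq V] {G : SimpleGraph V} (hG : G.Connected)
    (hcubic : ∀ v, nDeg G v = 3) {t : ℕ} (ht : 0 < t) (hn : Fintype.card V = 4 * t + 2) :
    ∃ A : Finset V, ∃ O ⊆ cutPairs G A, #A + 1 = 2 * t ∧
      Set.InjOn Prod.fst (O : Set (V × V)) ∧
      Set.InjOn Prod.snd (↑(cutPairs G A \ O) : Set (V × V)) ∧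
      (∃ p, #O + 2 * p = t) ∧ ∃ q, #(cutPairs G A \ O) + 2 * q = t + 1 := by
  obtain ⟨A, hA, hcut, hout, hin⟩ := exists_sparse_cut hG hcubic (2 * t - 2) (by omega)
  have hmod := card_cutPairs_mod_two hcubic A
  obtain ⟨m, hm⟩ : ∃ m, #(cutPairs G A) = 2 * m + 1 := ⟨#(cutPairs G A) / 2, by omega⟩
  obtain ⟨k, hmk, hkm, hkt⟩ : ∃ k, m ≤ k ∧ k ≤ m + 1 ∧ k % 2 = t % 2 := by
    by_cases h : m % 2 = t % 2
    · exact ⟨m, le_rfl, by omega, h⟩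
    · exact ⟨m + 1, by omega, le_rfl, by omega⟩
  suffices h : ∃ O ⊆ cutPairs G A, Set.InjOn Prod.fst (O : Set (V × V)) ∧
      Set.InjOn Prod.snd (↑(cutPairs G A \ O) : Set (V × V)) ∧ #O = k by
    obtain ⟨O, hO, hfst, hsnd, hk⟩ := h
    have := card_sdiff_add_card_eq_card hO
    exact ⟨A, O, hO, by omega, hfst, hsnd, ⟨(t - k) / 2, by omega⟩,
      ⟨(t + 1 - (2 * m + 1 - k)) / 2, by omega⟩⟩
  have hsnd : ∀ b, #{p ∈ cutPairs G A | p.2 = b} ≤ 2 := fun b => by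
    by_cases hb : b ∈ A
    · rw [card_eq_zero.2]
      · simp
      · refine filter_eq_empty_iff.2 fun p hp h => ?_
        exact (mem_cutPairs.1 hp).2.2 (h ▸ hb)
    · rw [card_filter_cutPairs_snd G A b hb]
      exact hout b hb
  rcases Nat.lt_or_ge 1 t with ht1 | ht1
  · refine exists_injOn_injOn_sdiff_card Prod.fst Prod.snd (cutPairs G A) (fun a => ?_) hsnd hm hmk
      hkm
    by_cases ha : a ∈ A
    · rw [card_filter_cutPairs_fst G A a ha]
      exact hin (by omega) a ha
    · rw [card_eq_zero.2]
      · simp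
      · refine filter_eq_empty_iff.2 fun p hp h => ?_
        exact ha (h ▸ (mem_cutPairs.1 hp).2.1)
  · obtain ⟨a, rfl⟩ := card_eq_one.1 (show #A = 1 by omega)
    have hk : k = 1 := by
      have := card_cutPairs_insert G (notMem_empty a)
      have h0 : cutPairs G ∅ = ∅ := by simp [cutPairs]
      have h0' : nbrsIn G ∅ a = ∅ := by simp [nbrsIn]
      rw [hcubic, h0, h0', card_empty, insert_empty_eq] at this
      omega
    obtain ⟨p, hp⟩ := card_pos.1 (show 0 < #(cutPairs G {a}) by omega)
    refine ⟨{p}, by simpa using hp, by simp, fun x hx y hy h => Prod.ext ?_ h, by simp [hk]⟩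
    rw [mem_singleton.1 (mem_cutPairs.1 (mem_sdiff.1 hx).1).2.1,
      mem_singleton.1 (mem_cutPairs.1 (mem_sdiff.1 hy).1).2.1]

end Cubic

theorem stmt10 {V : Type*} [Fintype V] (G : SimpleGraph V) (t : ℕ)
    (hn : Fintype.card V = 4 * t + 2) (hconn : G.Connected)
    (hcubic : ∀ v, nDeg G v = 3) :
    ∃ H ≤ G, degCount H 0 = t + 2 ∧ degCount H 1 = t + 1 ∧
      degCount H 2 = t ∧ degCount H 3 = t - 1 := by
  classical
  have ht : 0 < t := by
    obtain ⟨v⟩ := hconn.nonempty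
    have h := Set.ncard_le_card (G.neighborSet v)
    rw [← nDeg, hcubic, Nat.card_eq_fintype_card] at h
    omega
  obtain ⟨A, O, hO, hA, hfst, hsnd, ⟨p, hp⟩, q, hq⟩ := exists_split_cutPairs hconn hcubic ht hn
  obtain ⟨h2, h1, h23⟩ := degCount_pruneCut hcubic hO hfst hsnd
  have hle : pruneCut G A O ≤ G := fun _ _ h => h.1
  have hsum := sum_degCount hcubic hle
  exact exists_degCount_eq hcubic hle (by omega) (by omega) (h2 ▸ hp) (h1 ▸ hq)
end

section
/- Every 2-regular graph G of order n not isomorphic to the disjoint union of two triangles or the disjoint union of two 4-cycles contains a spanning subgraph H such that for every k ∈ {0,1,2}: |m(H,k) − n/3| ≤ 1 if n/3 is an odd integer, and |m(H,k) − n/3| ≤ 2/3 otherwise. -/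
open SimpleGraph

/-- The disjoint union of two triangles. -/
def twoC3 : SimpleGraph (Fin 2 × Fin 3) := SimpleGraph.fromRel (fun p q => p.1 = q.1)

/-- The disjoint union of two 4-cycles. -/
def twoC4 : SimpleGraph (Fin 2 × Fin 4) :=
  SimpleGraph.fromRel (fun p q => p.1 = q.1 ∧ (p.2.val + 1) % 4 = q.2.val)

theorem exists_between_sum_eq {ι : Type*} (s : Finset ι) (lo hi : ι → ℕ)
    (hle : ∀ i, lo i ≤ hi i) (T : ℕ) (hlo : ∑ i ∈ s, lo i ≤ T) (hhi : T ≤ ∑ i ∈ s, hi i) :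
    ∃ f : ι → ℕ, (∀ i, lo i ≤ f i ∧ f i ≤ hi i) ∧ ∑ i ∈ s, f i = T := by
  classical
  induction s using Finset.induction_on generalizing T with
  | empty => exact ⟨lo, fun i => ⟨le_rfl, hle i⟩, by simp_all⟩
  | insert a s ha ih =>
    rw [Finset.sum_insert ha] at hlo hhi
    have hs : ∑ i ∈ s, lo i ≤ ∑ i ∈ s, hi i := Finset.sum_le_sum fun i _ => hle i
    have ha' := hle a
    obtain ⟨x, hx1, hx2, hx3, hx4, hx5⟩ : ∃ x, lo a ≤ x ∧ x ≤ hi a ∧ x ≤ T ∧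
        ∑ i ∈ s, lo i ≤ T - x ∧ T - x ≤ ∑ i ∈ s, hi i :=
      ⟨min (hi a) (T - ∑ i ∈ s, lo i), by omega, by omega, by omega, by omega, by omega⟩
    obtain ⟨f, hf, hsum⟩ := ih (T - x) hx4 hx5
    refine ⟨Function.update f a x, fun i => ?_, ?_⟩
    · by_cases hi : i = a
      · subst hi; simpa using ⟨hx1, hx2⟩
      · simpa [hi] using hf i
    · rw [Finset.sum_insert ha, Function.update_self,
        Finset.sum_congr rfl fun i hi => Function.update_of_ne (by grind) x f, hsum]
      omega

/-- A cycle of length `c` has a spanning subgraph with `a` vertices of degree `0` and `b` of degree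
`2`; the number of the remaining vertices, all of degree `1`, is even. -/
def CycleSplit (c a b : ℕ) : Prop :=
  (a = c ∧ b = 0) ∨ (a = 0 ∧ b = c) ∨ ∃ j, 1 ≤ j ∧ a + b + 2 * j = c

theorem exists_split_of_disjoint {ι : Type*} [Fintype ι] [DecidableEq ι] {c : ι → ℕ} {m₀ t m₂ : ℕ}
    (hc : ∀ i, 2 ≤ c i) (hsum : ∑ i, c i = m₀ + 2 * t + m₂) {A B : Finset ι} (hAB : Disjoint A B)
    (hA : ∑ i ∈ A, c i ≤ m₀) (hB : ∑ i ∈ B, c i ≤ m₂) (hR : (A ∪ B)ᶜ.card ≤ t)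
    (ht : t ≤ ∑ i ∈ (A ∪ B)ᶜ, c i / 2) :
    ∃ a b : ι → ℕ, (∀ i, CycleSplit (c i) (a i) (b i)) ∧ ∑ i, a i = m₀ ∧ ∑ i, b i = m₂ := by
  have hdisj : ∀ i, i ∈ A → i ∉ B := fun _ hi => Finset.disjoint_left.1 hAB hi
  obtain ⟨j, hj, hjt⟩ := exists_between_sum_eq Finset.univ
    (fun i => if i ∈ (A ∪ B)ᶜ then 1 else 0) (fun i => if i ∈ (A ∪ B)ᶜ then c i / 2 else 0)
    (fun i => by have := hc i; split_ifs <;> omega) t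
    (by rw [Finset.sum_ite_mem, Finset.univ_inter]; simpa using hR)
    (by rw [Finset.sum_ite_mem, Finset.univ_inter]; exact ht)
  have key : ∑ i, (if i ∈ A then c i else if i ∈ B then 0 else c i - 2 * j i) + 2 * ∑ i, j i
      + ∑ i, (if i ∈ B then c i else 0) = ∑ i, c i := by
    rw [Finset.mul_sum, ← Finset.sum_add_distrib, ← Finset.sum_add_distrib]
    refine Finset.sum_congr rfl fun i _ => ?_
    have := hj i
    have := hdisj i
    simp only [Finset.mem_compl, Finset.mem_union] at *
    split_ifs at * <;> first | omega | tauto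
  have hB' : ∑ i, (if i ∈ B then c i else 0) = ∑ i ∈ B, c i := by
    rw [Finset.sum_ite_mem, Finset.univ_inter]
  obtain ⟨a, ha, ham⟩ := exists_between_sum_eq Finset.univ (fun i => if i ∈ A then c i else 0)
    (fun i => if i ∈ A then c i else if i ∈ B then 0 else c i - 2 * j i)
    (fun i => by split_ifs <;> omega) m₀
    (by rw [Finset.sum_ite_mem, Finset.univ_inter]; exact hA) (by omega)
  have hle : ∀ i, a i + 2 * j i ≤ c i := fun i => by
    have := hj i
    have := ha i
    simp only [Finset.mem_compl, Finset.mem_union] at *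
    split_ifs at * <;> first | omega | tauto
  refine ⟨a, fun i => c i - 2 * j i - a i, fun i => ?_, ham, ?_⟩
  · have := hj i
    have := ha i
    have := hle i
    have := hc i
    simp only [Finset.mem_compl, Finset.mem_union] at *
    by_cases h1 : i ∈ A
    · simp only [h1, true_or, not_true, if_false, if_true] at *
      exact Or.inl ⟨by omega, by omega⟩
    · by_cases h2 : i ∈ B
      · simp only [h1, h2, or_true, not_true, if_false, if_true] at *
        exact Or.inr (Or.inl ⟨by omega, by omega⟩)
      · simp only [h1, h2, or_self, not_false_eq_true, if_false, if_true] at *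
        exact Or.inr (Or.inr ⟨j i, by omega, by omega⟩)
  · have : ∑ i, a i + 2 * ∑ i, j i + ∑ i, (c i - 2 * j i - a i) = ∑ i, c i := by
      rw [Finset.mul_sum, ← Finset.sum_add_distrib, ← Finset.sum_add_distrib]
      exact Finset.sum_congr rfl fun i _ => by have := hle i; omega
    change ∑ i, (c i - 2 * j i - a i) = m₂
    omega

theorem exists_split {ι : Type*} [Fintype ι] {c : ι → ℕ} {m₀ t m₂ : ℕ}
    (hc : ∀ i, 3 ≤ c i) (hsum : ∑ i, c i = m₀ + 2 * t + m₂) (ht : t ≤ m₀ + m₂)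
    (h : 2 ≤ t ∨ Fintype.card ι ≤ t) :
    ∃ a b : ι → ℕ, (∀ i, CycleSplit (c i) (a i) (b i)) ∧ ∑ i, a i = m₀ ∧ ∑ i, b i = m₂ := by
  classical
  have hc2 : ∀ i, 2 ≤ c i := fun i => by have := hc i; omega
  by_cases hr : Fintype.card ι ≤ t
  · refine exists_split_of_disjoint (A := ∅) (B := ∅) hc2 hsum (by simp) (by simp) (by simp)
      (by simpa using hr) ?_
    have h3 : ∑ i, c i ≤ ∑ i, 3 * (c i / 2) :=
      Finset.sum_le_sum fun i _ => by have := hc i; omega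
    rw [← Finset.mul_sum] at h3
    simp only [Finset.union_empty, Finset.compl_empty]
    omega
  have ht2 : 2 ≤ t := h.resolve_right hr
  let P : Finset (Finset ι × Finset ι) := Finset.univ.filter fun p =>
    Disjoint p.1 p.2 ∧ ∑ i ∈ p.1, c i ≤ m₀ ∧ ∑ i ∈ p.2, c i ≤ m₂ ∧ t ≤ (p.1 ∪ p.2)ᶜ.card
  obtain ⟨⟨A, B⟩, hp, hmin⟩ := P.exists_min_image (fun p => (p.1 ∪ p.2)ᶜ.card)
    ⟨(∅, ∅), by simp [P]; omega⟩
  simp only [P, Finset.mem_filter, Finset.mem_univ, true_and] at hp hmin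
  obtain ⟨hd, hA, hB, hR⟩ := hp
  have hRsum : ∑ i ∈ (A ∪ B)ᶜ, 1 ≤ ∑ i ∈ (A ∪ B)ᶜ, c i / 2 :=
    Finset.sum_le_sum fun i _ => by have := hc i; omega
  refine exists_split_of_disjoint hc2 hsum hd hA hB ?_ (by rw [← Finset.card_eq_sum_ones] at hRsum; omega)
  by_contra! hlt
  obtain ⟨x, hx, hxmin⟩ := (A ∪ B)ᶜ.exists_min_image c (Finset.card_pos.1 (by omega))
  have hxA : x ∉ A := by simp at hx; tauto
  have hxB : x ∉ B := by simp at hx; tauto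
  have hA' : m₀ < c x + ∑ i ∈ A, c i := by
    by_contra! hle
    have he : (insert x A ∪ B)ᶜ = (A ∪ B)ᶜ.erase x := by ext; simp
    have := hmin (insert x A, B) ⟨by simp [hxB, hd], by rwa [Finset.sum_insert hxA], hB, by
      dsimp only; rw [he, Finset.card_erase_of_mem hx]; omega⟩
    dsimp only at this
    rw [he, Finset.card_erase_of_mem hx] at this
    omega
  have hB' : m₂ < c x + ∑ i ∈ B, c i := by
    by_contra! hle
    have he : (A ∪ insert x B)ᶜ = (A ∪ B)ᶜ.erase x := by ext; simp
    have := hmin (A, insert x B) ⟨by simp [hxA, hd], hA, by rwa [Finset.sum_insert hxB], by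
      dsimp only; rw [he, Finset.card_erase_of_mem hx]; omega⟩
    dsimp only at this
    rw [he, Finset.card_erase_of_mem hx] at this
    omega
  have hrest : (A ∪ B)ᶜ.card * c x ≤ ∑ i ∈ (A ∪ B)ᶜ, c i :=
    Finset.card_nsmul_le_sum _ _ _ hxmin
  have htot := Finset.sum_add_sum_compl (A ∪ B) c
  rw [Finset.sum_union hd] at htot
  have hcx := hc x
  have : (t + 1) * c x ≤ (A ∪ B)ᶜ.card * c x := Nat.mul_le_mul_right _ hlt
  nlinarith

theorem ncard_fin_setOf_val_mem_Ico {n : ℕ} (a b : ℕ) (hb : b ≤ n) :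
    {i : Fin n | a ≤ i.val ∧ i.val < b}.ncard = b - a := by
  rw [← Set.ncard_image_of_injective _ Fin.val_injective]
  have : Fin.val '' {i : Fin n | a ≤ i.val ∧ i.val < b} = (Finset.Ico a b : Finset ℕ) := by
    ext x
    simp only [Set.mem_image, Set.mem_ofPred_eq, Finset.coe_Ico, Set.mem_Ico]
    exact ⟨by rintro ⟨y, h, rfl⟩; exact h, fun h => ⟨⟨x, by omega⟩, h, rfl⟩⟩
  rw [this, Set.ncard_coe_finset, Nat.card_Ico]

theorem CycleSplit.exists_edges {m a b : ℕ} (h : CycleSplit (m + 3) a b) :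
    ∃ E : Fin (m + 3) → Prop,
      {i | ¬ E i ∧ ¬ E (i - 1)}.ncard = a ∧ {i | E i ∧ E (i - 1)}.ncard = b := by
  rcases h with ⟨rfl, rfl⟩ | ⟨rfl, rfl⟩ | ⟨j, hj, h⟩
  · exact ⟨fun _ => False, by simp, by simp⟩
  · exact ⟨fun _ => True, by simp, by simp⟩
  · refine ⟨fun i => i.val < b + 1 ∨
      (b + 2 ≤ i.val ∧ i.val + 1 < b + 2 * j ∧ (i.val - b) % 2 = 0), ?_, ?_⟩
    · rw [show a = m + 3 - (b + 2 * j) by omega,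
        ← ncard_fin_setOf_val_mem_Ico (n := m + 3) (b + 2 * j) (m + 3) le_rfl]
      congr 1
      ext i
      have := i.2
      simp only [Set.mem_ofPred_eq, Fin.coe_sub_one, Fin.ext_iff, Fin.val_zero]
      split_ifs <;> omega
    · refine (congrArg Set.ncard ?_).trans
        (ncard_fin_setOf_val_mem_Ico (n := m + 3) 1 (b + 1) (by omega))
      ext i
      have := i.2
      simp only [Set.mem_ofPred_eq, Fin.coe_sub_one, Fin.ext_iff, Fin.val_zero]
      split_ifs <;> omega

/-- The graph whose edges join `f i` to `f (i + 1)` for those `i` with `E i`. -/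
def cyclicGraph {V : Type*} {m : ℕ} (f : Fin (m + 3) → V) (E : Fin (m + 3) → Prop) :
    SimpleGraph V :=
  SimpleGraph.fromRel fun v w => ∃ i, E i ∧ v = f i ∧ w = f (i + 1)

theorem Fin.sub_one_ne_add_one {m : ℕ} (i : Fin (m + 3)) : i - 1 ≠ i + 1 := by
  intro h
  have h2 : (1 : Fin (m + 3)) + 1 = 0 := by
    rw [← sub_eq_zero] at h
    rw [← neg_eq_zero, ← h]
    abel
  have := congrArg Fin.val h2
  simp only [Fin.val_add, Fin.val_one, Fin.val_zero] at this
  rw [Nat.mod_eq_of_lt (by omega)] at this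
  omega

section
variable {V : Type*} {m : ℕ} {f : Fin (m + 3) → V}

theorem neighborSet_cyclicGraph (hf : Function.Injective f) (E : Fin (m + 3) → Prop)
    (i : Fin (m + 3)) :
    (cyclicGraph f E).neighborSet (f i) =
      {v | E i ∧ v = f (i + 1)} ∪ {v | E (i - 1) ∧ v = f (i - 1)} := by
  ext v
  simp only [cyclicGraph, mem_neighborSet, fromRel_adj, Set.mem_union, Set.mem_ofPred_eq]
  constructor
  · rintro ⟨-, ⟨j, hj, h1, h2⟩ | ⟨j, hj, h1, h2⟩⟩
    · obtain rfl := hf h1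
      exact Or.inl ⟨hj, h2⟩
    · obtain rfl := hf h2
      exact Or.inr ⟨by simpa using hj, by simpa using h1⟩
  · rintro (⟨h, rfl⟩ | ⟨h, rfl⟩)
    · exact ⟨hf.ne (by simp), Or.inl ⟨i, h, rfl, rfl⟩⟩
    · exact ⟨(hf.ne (by simp)).symm, Or.inr ⟨i - 1, h, rfl, by simp⟩⟩

theorem nDeg_cyclicGraph (hf : Function.Injective f) (E : Fin (m + 3) → Prop)
    [DecidablePred E] (i : Fin (m + 3)) :
    nDeg (cyclicGraph f E) (f i) = (if E i then 1 else 0) + (if E (i - 1) then 1 else 0) := by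
  have hne : f (i - 1) ≠ f (i + 1) := hf.ne (Fin.sub_one_ne_add_one i)
  rw [nDeg, neighborSet_cyclicGraph hf]
  by_cases h1 : E i <;> by_cases h2 : E (i - 1)
  · simpa [h1, h2, Set.singleton_union] using Set.ncard_pair hne
  all_goals simp [h1, h2]

theorem ncard_setOf_mem_range (hf : Function.Injective f) (P : V → Prop) :
    {v | v ∈ Set.range f ∧ P v}.ncard = {i | P (f i)}.ncard := by
  rw [← Set.ncard_image_of_injective _ hf]
  congr 1
  ext v
  simp only [Set.mem_ofPred_eq, Set.mem_range, Set.mem_image]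
  grind

theorem CycleSplit.exists_subgraph {G : SimpleGraph V} {a b : ℕ}
    (hf : Function.Injective f) (hadj : ∀ i, G.Adj (f i) (f (i + 1)))
    (h : CycleSplit (m + 3) a b) :
    ∃ H ≤ G, {v | v ∈ Set.range f ∧ nDeg H v = 0}.ncard = a ∧
      {v | v ∈ Set.range f ∧ nDeg H v = 2}.ncard = b ∧ ∀ v ∈ Set.range f, nDeg H v ≤ 2 := by
  classical
  obtain ⟨E, h0, h2⟩ := h.exists_edges
  refine ⟨cyclicGraph f E, ?_, ?_, ?_, ?_⟩
  · intro v w hvw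
    rw [cyclicGraph, fromRel_adj] at hvw
    obtain ⟨-, ⟨i, -, rfl, rfl⟩ | ⟨i, -, rfl, rfl⟩⟩ := hvw
    exacts [hadj i, (hadj i).symm]
  · rw [ncard_setOf_mem_range hf, ← h0]
    congr 1
    ext i
    simp only [Set.mem_ofPred_eq, nDeg_cyclicGraph hf]
    split_ifs <;> simp_all
  · rw [ncard_setOf_mem_range hf, ← h2]
    congr 1
    ext i
    simp only [Set.mem_ofPred_eq, nDeg_cyclicGraph hf]
    split_ifs <;> simp_all
  · rintro _ ⟨i, rfl⟩
    rw [nDeg_cyclicGraph hf]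
    split_ifs <;> omega
end

section
variable {V : Type*} [Finite V] {G : SimpleGraph V}

theorem exists_cyclic_enumeration (h2reg : ∀ v, nDeg G v = 2) (C : G.ConnectedComponent) :
    ∃ (m : ℕ) (f : Fin (m + 3) → V), Function.Injective f ∧ Set.range f = C.supp ∧
      ∀ i, G.Adj (f i) (f (i + 1)) := by
  obtain ⟨v, hv⟩ := C.nonempty_supp
  have hn : (G.neighborSet v).Nonempty := by
    refine Set.nonempty_of_ncard_ne_zero ?_
    rw [show (G.neighborSet v).ncard = 2 from h2reg v]
    decide
  have hcyc : G.IsCycles := fun v _ => h2reg v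
  obtain ⟨p, hp, hC⟩ := hcyc.exists_cycle_toSubgraph_verts_eq_connectedComponentSupp hv hn
  obtain ⟨m, hm⟩ := Nat.exists_eq_add_of_le' hp.three_le_length
  refine ⟨m, fun i => p.getVert i, fun i j hij => ?_, ?_, fun i => ?_⟩
  · exact Fin.ext (hp.getVert_injOn' (by have := i.2; simp; omega)
      (by have := j.2; simp; omega) hij)
  · rw [← hC]
    ext w
    simp only [Set.mem_range, Walk.mem_verts_toSubgraph, Walk.mem_support_iff_exists_getVert]
    constructor
    · rintro ⟨i, rfl⟩
      exact ⟨i, rfl, by omega⟩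
    · rintro ⟨n, rfl, hn⟩
      by_cases hnm : n < m + 3
      · exact ⟨⟨n, hnm⟩, rfl⟩
      · refine ⟨0, ?_⟩
        rw [show n = p.length by omega]
        simp
  · have hadj := p.adj_getVert_succ (i := i) (by have := i.2; omega)
    dsimp only
    rw [Fin.val_add_one]
    split_ifs with h
    · subst h
      have : p.getVert (m + 2 + 1) = v := by
        rw [show m + 2 + 1 = p.length by omega, Walk.getVert_length]
      simpa [this] using hadj
    · exact hadj

theorem cyclic_adj_iff (h2reg : ∀ v, nDeg G v = 2) {m : ℕ} {f : Fin (m + 3) → V}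
    (hf : Function.Injective f) (hadj : ∀ i, G.Adj (f i) (f (i + 1))) (i : Fin (m + 3)) (w : V) :
    G.Adj (f i) w ↔ w = f (i + 1) ∨ w = f (i - 1) := by
  have hne : f (i + 1) ≠ f (i - 1) := hf.ne (Fin.sub_one_ne_add_one i).symm
  have hsub : {f (i + 1), f (i - 1)} ⊆ G.neighborSet (f i) := by
    rintro _ (rfl | rfl)
    · exact hadj i
    · simpa using (hadj (i - 1)).symm
  have := Set.eq_of_subset_of_ncard_le hsub
    (by rw [Set.ncard_pair hne]; exact (h2reg (f i)).le) (Set.toFinite _)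
  rw [← mem_neighborSet, ← this]
  simp

theorem sum_ncard_component (P : V → Prop) [Fintype G.ConnectedComponent] :
    ∑ C : G.ConnectedComponent, {v | v ∈ C.supp ∧ P v}.ncard = {v | P v}.ncard := by
  classical
  have := Fintype.ofFinite V
  rw [Set.ncard_eq_toFinset_card', Finset.card_eq_sum_card_fiberwise
    (f := G.connectedComponentMk) (t := Finset.univ) (by simp)]
  refine Finset.sum_congr rfl fun C _ => ?_
  rw [Set.ncard_eq_toFinset_card']
  congr 1
  ext v
  simp [and_comm]

theorem exists_subgraph_of_split (h2reg : ∀ v, nDeg G v = 2) [Fintype G.ConnectedComponent]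
    {a b : G.ConnectedComponent → ℕ} (hab : ∀ C, CycleSplit C.supp.ncard (a C) (b C)) :
    ∃ H ≤ G, degCount H 0 = ∑ C, a C ∧ degCount H 2 = ∑ C, b C ∧
      degCount H 0 + degCount H 1 + degCount H 2 = Nat.card V := by
  have hcomp : ∀ C : G.ConnectedComponent, ∃ H ≤ G,
      {v | v ∈ C.supp ∧ nDeg H v = 0}.ncard = a C ∧
      {v | v ∈ C.supp ∧ nDeg H v = 2}.ncard = b C ∧ ∀ v ∈ C.supp, nDeg H v ≤ 2 := by
    intro C
    obtain ⟨m, f, hf, hr, hadj⟩ := exists_cyclic_enumeration h2reg C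
    have hsplit := hab C
    rw [← hr] at hsplit ⊢
    rw [← Set.image_univ, Set.ncard_image_of_injective _ hf, Set.ncard_univ, Nat.card_fin] at hsplit
    exact hsplit.exists_subgraph hf hadj
  choose H hle h0 h2 hle2 using hcomp
  let K : SimpleGraph V :=
    { Adj := fun v w => (H (G.connectedComponentMk v)).Adj v w
      symm := ⟨fun v w h => by
        rw [← ConnectedComponent.connectedComponentMk_eq_of_adj (hle _ h)]
        exact h.symm⟩
      loopless := ⟨fun v h => h.ne rfl⟩ }
  have hdeg : ∀ C : G.ConnectedComponent, ∀ v ∈ C.supp, nDeg K v = nDeg (H C) v := by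
    rintro _ v rfl
    rfl
  have hle' : ∀ v, nDeg K v ≤ 2 := fun v => by
    rw [hdeg _ v rfl]
    exact hle2 _ v rfl
  have hcount : ∀ k, degCount K k = ∑ C, {v | v ∈ C.supp ∧ nDeg (H C) v = k}.ncard := by
    intro k
    rw [degCount, ← sum_ncard_component (G := G)]
    refine Finset.sum_congr rfl fun C _ => ?_
    congr 1
    ext v
    simp only [Set.mem_ofPred_eq]
    exact and_congr_right fun hv => by rw [hdeg C v hv]
  refine ⟨K, fun v w h => hle _ h, by simp only [hcount, h0], by simp only [hcount, h2], ?_⟩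
  rw [degCount, degCount, degCount, ← Set.ncard_union_eq, ← Set.ncard_union_eq, ← Set.ncard_univ]
  · congr 1
    ext v
    have := hle' v
    simp only [Set.mem_union, Set.mem_ofPred_eq, Set.mem_univ, iff_true]
    omega
  · rw [Set.disjoint_left]
    simp only [Set.mem_union, Set.mem_ofPred_eq]
    omega
  · rw [Set.disjoint_left]
    simp only [Set.mem_ofPred_eq]
    omega

theorem nonempty_iso_of_two_components (h2reg : ∀ v, nDeg G v = 2)
    {C D : G.ConnectedComponent} (hCD : C ≠ D) (hall : ∀ E, E = C ∨ E = D) {m : ℕ}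
    (hC : C.supp.ncard = m + 3) (hD : D.supp.ncard = m + 3) {K : SimpleGraph (Fin 2 × Fin (m + 3))}
    (hK : ∀ p q, K.Adj p q ↔ p.1 = q.1 ∧ (q.2 = p.2 + 1 ∨ q.2 = p.2 - 1)) :
    Nonempty (G ≃g K) := by
  have henum : ∀ E : G.ConnectedComponent, E.supp.ncard = m + 3 → ∃ f : Fin (m + 3) → V,
      Function.Injective f ∧ Set.range f = E.supp ∧ ∀ i, G.Adj (f i) (f (i + 1)) := by
    intro E hE
    obtain ⟨m', f, hf, hr, hadj⟩ := exists_cyclic_enumeration h2reg E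
    rw [← hr, ← Set.image_univ, Set.ncard_image_of_injective _ hf, Set.ncard_univ,
      Nat.card_fin] at hE
    obtain rfl : m' = m := by omega
    exact ⟨f, hf, hr, hadj⟩
  let S : Fin 2 → G.ConnectedComponent := ![C, D]
  have hS : Function.Injective S := by
    intro i j h
    fin_cases i <;> fin_cases j <;> simp_all [S, hCD.symm]
  have hScard : ∀ i, (S i).supp.ncard = m + 3 := by
    intro i
    fin_cases i <;> simp [S, hC, hD]
  choose f hf hr hadj using fun i => henum (S i) (hScard i)
  have hmk : ∀ i x, G.connectedComponentMk (f i x) = S i := fun i x => by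
    have : f i x ∈ (S i).supp := hr i ▸ Set.mem_range_self x
    exact this
  have hinj : Function.Injective fun p : Fin 2 × Fin (m + 3) => f p.1 p.2 := by
    rintro ⟨i, x⟩ ⟨j, y⟩ h
    obtain rfl : i = j := hS (by rw [← hmk i x, ← hmk j y]; exact congrArg _ h)
    exact congrArg (Prod.mk i) (hf i h)
  have hsurj : Function.Surjective fun p : Fin 2 × Fin (m + 3) => f p.1 p.2 := by
    intro v
    obtain ⟨i, hi⟩ : ∃ i, G.connectedComponentMk v = S i :=
      (hall _).elim (fun h => ⟨0, h⟩) (fun h => ⟨1, h⟩)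
    have : v ∈ Set.range (f i) := hr i ▸ hi
    obtain ⟨x, rfl⟩ := this
    exact ⟨(i, x), rfl⟩
  refine ⟨RelIso.symm ⟨Equiv.ofBijective _ ⟨hinj, hsurj⟩, ?_⟩⟩
  rintro ⟨i, x⟩ ⟨j, y⟩
  rw [hK]
  change G.Adj (f i x) (f j y) ↔ _
  rw [cyclic_adj_iff h2reg (hf i) (hadj i)]
  have h1 := hinj.eq_iff (a := (j, y)) (b := (i, x + 1))
  have h2 := hinj.eq_iff (a := (j, y)) (b := (i, x - 1))
  dsimp only at h1 h2
  rw [h1, h2, Prod.mk.injEq, Prod.mk.injEq, ← and_or_left, eq_comm]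

end

theorem twoC3_adj_iff (p q : Fin 2 × Fin 3) :
    twoC3.Adj p q ↔ p.1 = q.1 ∧ (q.2 = p.2 + 1 ∨ q.2 = p.2 - 1) := by
  simp only [twoC3, fromRel_adj]
  revert p q
  decide

theorem twoC4_adj_iff (p q : Fin 2 × Fin 4) :
    twoC4.Adj p q ↔ p.1 = q.1 ∧ (q.2 = p.2 + 1 ∨ q.2 = p.2 - 1) := by
  simp only [twoC4, fromRel_adj]
  revert p q
  decide

theorem exists_balanced_split {n : ℕ} {V : Type*} [Fintype V] (hn : Fintype.card V = n)
    {G : SimpleGraph V} [Fintype G.ConnectedComponent] (h2reg : ∀ v, nDeg G v = 2)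
    (h1 : ¬ Nonempty (G ≃g twoC3)) (h2 : ¬ Nonempty (G ≃g twoC4)) :
    ∃ a b : G.ConnectedComponent → ℕ, (∀ C, CycleSplit C.supp.ncard (a C) (b C)) ∧
      ∑ C, a C = (n - 2 * ((n + 3) / 6) + 1) / 2 ∧ ∑ C, b C = (n - 2 * ((n + 3) / 6)) / 2 := by
  classical
  have hc : ∀ C : G.ConnectedComponent, 3 ≤ C.supp.ncard := fun C => by
    obtain ⟨m, f, hf, hr, -⟩ := exists_cyclic_enumeration h2reg C
    rw [← hr, ← Set.image_univ, Set.ncard_image_of_injective _ hf, Set.ncard_univ, Nat.card_fin]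
    omega
  have hsum : ∑ C : G.ConnectedComponent, C.supp.ncard = n := by
    rw [← hn, ← Nat.card_eq_fintype_card, ← Set.ncard_univ]
    have := sum_ncard_component (G := G) fun _ => True
    simp only [and_true] at this
    exact this
  have hr : 3 * Fintype.card G.ConnectedComponent ≤ n := by
    rw [← hsum, mul_comm]
    exact Finset.card_nsmul_le_sum _ _ _ fun C _ => hc C
  by_cases h : 2 ≤ (n + 3) / 6 ∨ Fintype.card G.ConnectedComponent ≤ (n + 3) / 6
  · exact exists_split hc (t := (n + 3) / 6) (by omega) (by omega) h
  have hcard : Fintype.card G.ConnectedComponent = 2 := by omega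
  obtain ⟨C, D, hCD, huniv⟩ := Finset.card_eq_two.1 (Finset.card_univ.trans hcard)
  have hall : ∀ E, E = C ∨ E = D := fun E => by simpa [huniv] using Finset.mem_univ E
  have hCDn : C.supp.ncard + D.supp.ncard = n := by rw [← hsum, huniv, Finset.sum_pair hCD]
  have hsplit : ∀ E F : G.ConnectedComponent, Finset.univ = {E, F} → E ≠ F →
      E.supp.ncard = 3 → 7 ≤ n → ∃ a b : G.ConnectedComponent → ℕ,
        (∀ C, CycleSplit C.supp.ncard (a C) (b C)) ∧
        ∑ C, a C = (n - 2 * ((n + 3) / 6) + 1) / 2 ∧ ∑ C, b C = (n - 2 * ((n + 3) / 6)) / 2 := by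
    intro E F hEF hne hE h7
    have hR : ({E} ∪ ∅ : Finset G.ConnectedComponent)ᶜ = {F} := by
      rw [Finset.union_empty, Finset.compl_eq_univ_sdiff, hEF]
      ext X
      simp only [Finset.mem_sdiff, Finset.mem_insert, Finset.mem_singleton]
      grind
    refine exists_split_of_disjoint (t := (n + 3) / 6) (A := {E}) (B := ∅)
      (fun X => by have := hc X; omega) (by omega) (by simp) ?_ (by simp) ?_ ?_
    · rw [Finset.sum_singleton]
      omega
    · rw [hR, Finset.card_singleton]
      omega
    · rw [hR, Finset.sum_singleton]
      have := hc F
      omega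
  have hC3 := hc C
  have hD3 := hc D
  by_cases h3 : C.supp.ncard = 3 ∧ D.supp.ncard = 3
  · exact absurd (nonempty_iso_of_two_components h2reg hCD hall h3.1 h3.2 twoC3_adj_iff) h1
  by_cases h4 : C.supp.ncard = 4 ∧ D.supp.ncard = 4
  · exact absurd (nonempty_iso_of_two_components h2reg hCD hall h4.1 h4.2 twoC4_adj_iff) h2
  by_cases hC : C.supp.ncard = 3
  · exact hsplit C D huniv hCD hC (by omega)
  · exact hsplit D C (huniv.trans (Finset.pair_comm C D)) hCD.symm (by omega) (by omega)

theorem stmt19 {V : Type*} [Fintype V] (G : SimpleGraph V)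
    (h2reg : ∀ v, nDeg G v = 2)
    (h1 : ¬ Nonempty (G ≃g twoC3)) (h2 : ¬ Nonempty (G ≃g twoC4)) :
    ∃ H ≤ G,
      ((∃ m, Fintype.card V = 3 * m ∧ Odd m) →
        ∀ k ≤ 2, |(degCount H k : ℚ) - (Fintype.card V : ℚ) / 3| ≤ 1) ∧
      (¬ (∃ m, Fintype.card V = 3 * m ∧ Odd m) →
        ∀ k ≤ 2, |(degCount H k : ℚ) - (Fintype.card V : ℚ) / 3| ≤ 2 / 3) := by
  classical
  have := Fintype.ofFinite G.ConnectedComponent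
  obtain ⟨a, b, hab, ha, hb⟩ := exists_balanced_split rfl h2reg h1 h2
  obtain ⟨H, hle, h0, h2, htot⟩ := exists_subgraph_of_split h2reg hab
  rw [Nat.card_eq_fintype_card] at htot
  rw [ha] at h0
  rw [hb] at h2
  generalize Fintype.card V = n at *
  have hbound : ∀ e k : ℕ, 3 * degCount H k ≤ n + e → n ≤ 3 * degCount H k + e →
      |(degCount H k : ℚ) - (n : ℚ) / 3| ≤ e / 3 := by
    intro e k hu hl
    have hu' : (3 * degCount H k : ℚ) ≤ n + e := by exact_mod_cast hu
    have hl' : (n : ℚ) ≤ 3 * degCount H k + e := by exact_mod_cast hl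
    rw [abs_le]
    constructor <;> linarith
  refine ⟨H, hle, ?_, ?_⟩
  · rintro ⟨m, hm, l, hl⟩ k hk
    have := hbound 3 k
    norm_num at this
    interval_cases k <;> exact this (by omega) (by omega)
  · intro hodd k hk
    have hn : n % 6 ≠ 3 := fun h => hodd ⟨n / 3, by omega, n / 6, by omega⟩
    have := hbound 2 k
    norm_num at this
    interval_cases k <;> exact this (by omega) (by omega)
end
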